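/- For every 0 ≤ p < q ≤ n and all natural numbers z₁, z₂ with z₁ + a z₂ ≡ i_q − i_p (mod r), there is a path in the labelled quiver from vertex p to vertex q with total label (z₁, z₂). (Every map S_{i_p} → S_{i_q} with p < q can be seen in the diagram of special Cohen–Macaulay modules.) -/

import Mathlib

/-- The two-step linear recursion `s₀ = x0`, `s₁ = x1`, `s_{t+1} = α_t s_t − s_{t−1}`;
with `x0 = r, x1 = a` this is the i-series and with `x0 = 0, x1 = 1` the j-series. -/
def ser (x0 x1 : ℤ) (α : ℕ → ℕ) : ℕ → ℤ
  | 0 => x0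
  | 1 => x1
  | t + 2 => (α (t + 1) : ℤ) * ser x0 x1 α (t + 1) - ser x0 x1 α t

/-- Hirzebruch–Jung (negative) continued fraction value of a list. -/
def hj : List ℚ → ℚ
  | [] => 0
  | q :: L => q - 1 / hj L

/-- `Arrow r a n α v w ℓ` : there is an arrow `v → w` with label `ℓ = (ℓ₁, ℓ₂)` in the
labelled quiver of the diagram of special CM modules: clockwise arrows `t → t−1` with
label `(i_{t−1} − i_t, 0)` and `0 → n` with label `(1,0)`; anticlockwise arrows
`t → t+1` with label `(0, j_{t+1} − j_t)` and `n → 0` with label `(0, r − jₙ)`; and for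
`1 ≤ t ≤ n`, `1 ≤ s ≤ α_t − 2`, extra arrows `t → 0` with label
`(i_{t−1} − (s+1) i_t, s j_t − j_{t−1})`. -/
def Arrow (r a n : ℕ) (α : ℕ → ℕ) (v w : ℕ) (ℓ : ℕ × ℕ) : Prop :=
  (∃ t, 1 ≤ t ∧ t ≤ n ∧ v = t ∧ w = t - 1 ∧
    ℓ = ((ser r a α (t - 1) - ser r a α t).toNat, 0)) ∨
  (v = 0 ∧ w = n ∧ ℓ = (1, 0)) ∨
  (∃ t, t + 1 ≤ n ∧ v = t ∧ w = t + 1 ∧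
    ℓ = (0, (ser 0 1 α (t + 1) - ser 0 1 α t).toNat)) ∨
  (v = n ∧ w = 0 ∧ ℓ = (0, ((r : ℤ) - ser 0 1 α n).toNat)) ∨
  (∃ t s, 1 ≤ t ∧ t ≤ n ∧ 1 ≤ s ∧ s ≤ α t - 2 ∧ v = t ∧ w = 0 ∧
    ℓ = ((ser r a α (t - 1) - ((s : ℤ) + 1) * ser r a α t).toNat,
         ((s : ℤ) * ser 0 1 α t - ser 0 1 α (t - 1)).toNat))

/-- One step of the labelled quiver: move along an arrow, adding its label to the
running total. -/
def StepQ (r a n : ℕ) (α : ℕ → ℕ) (x y : ℕ × ℕ × ℕ) : Prop :=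
  ∃ ℓ : ℕ × ℕ, Arrow r a n α x.1 y.1 ℓ ∧ y.2.1 = x.2.1 + ℓ.1 ∧ y.2.2 = x.2.2 + ℓ.2

/-- There is a path from vertex `p` to vertex `q` with total label `(z₁, z₂)`. -/
def HasPath (r a n : ℕ) (α : ℕ → ℕ) (p q z₁ z₂ : ℕ) : Prop :=
  Relation.ReflTransGen (StepQ r a n α) (p, 0, 0) (q, z₁, z₂)


theorem ser_succ (x0 x1 : ℤ) (α : ℕ → ℕ) (t : ℕ) :
    ser x0 x1 α (t + 1) = ser x1 (α 1 * x1 - x0) (fun k => α (k + 1)) t := by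
  induction t using Nat.twoStepInduction with
  | zero => rfl
  | one => rfl
  | more t ih₁ ih₂ => rw [ser, ih₁, ih₂]; rfl

/-- Consecutive terms of the i- and j-series have constant determinant. -/
theorem ser_det (r a : ℤ) (α : ℕ → ℕ) (t : ℕ) :
    ser r a α t * ser 0 1 α (t + 1) - ser r a α (t + 1) * ser 0 1 α t = r := by
  induction t with
  | zero => simp [ser]
  | succ t ih => simp only [ser] at ih ⊢; linear_combination ih

theorem dvd_ser_sub (r a : ℤ) (α : ℕ → ℕ) (t : ℕ) :
    r ∣ ser r a α t - a * ser 0 1 α t := by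
  induction t using Nat.twoStepInduction with
  | zero => simp [ser]
  | one => simp [ser]
  | more t ih₁ ih₂ =>
    simp only [ser]
    refine dvd_trans ((ih₂.mul_left (α (t + 1) : ℤ)).sub ih₁) (dvd_of_eq ?_)
    ring

theorem one_lt_hj {L : List ℚ} (hL : L ≠ []) (h : ∀ q ∈ L, 2 ≤ q) : 1 < hj L := by
  induction L with
  | nil => exact absurd rfl hL
  | cons q L ih =>
    have hq : 2 ≤ q := h q (by simp)
    rcases eq_or_ne L [] with rfl | hne
    · simp only [hj]; norm_num; linarith
    · have hlt := ih hne fun x hx => h x (by simp [hx])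
      have : 1 / hj L < 1 := (div_lt_one (by linarith)).2 hlt
      simp only [hj]
      linarith

/-- A series whose initial ratio is the value of the continued fraction decreases to zero. -/
theorem ser_anti_of_hj (m : ℕ) : ∀ (α : ℕ → ℕ) (x0 x1 : ℤ),
    (∀ t, 1 ≤ t → t ≤ m + 1 → 2 ≤ α t) → 0 < x1 →
    hj ((List.range (m + 1)).map fun t => (α (t + 1) : ℚ)) = (x0 : ℚ) / x1 →
    (∀ t, t ≤ m + 1 → ser x0 x1 α (t + 1) < ser x0 x1 α t ∧ 0 ≤ ser x0 x1 α (t + 1)) ∧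
      ser x0 x1 α (m + 2) = 0 := by
  induction m with
  | zero =>
    intro α x0 x1 hα hx1 hval
    have h2 := hα 1 le_rfl le_rfl
    have hx : (0 : ℚ) < x1 := by exact_mod_cast hx1
    have hval' : (α 1 : ℚ) = x0 / x1 := by simpa [hj] using hval
    rw [eq_div_iff hx.ne'] at hval'
    have h0 : (α 1 : ℤ) * x1 = x0 := by exact_mod_cast hval'
    refine ⟨fun t ht => ?_, by simp [ser, h0]⟩
    have h2' : (2 : ℤ) ≤ α 1 := by exact_mod_cast h2
    interval_cases t
    · simp only [ser]; constructor <;> nlinarith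
    · simp only [ser]; constructor <;> simp <;> omega
  | succ m ih =>
    intro α x0 x1 hα hx1 hval
    have hx : (0 : ℚ) < x1 := by exact_mod_cast hx1
    rw [List.range_succ_eq_map, List.map_cons, List.map_map] at hval
    set L : List ℚ := (List.range (m + 1)).map fun t => (α (t + 1 + 1) : ℚ) with hL
    have hval' : (α 1 : ℚ) - 1 / hj L = x0 / x1 := hval
    have hgt : 1 < hj L := by
      refine one_lt_hj (by simp [hL]) fun q hq => ?_
      simp only [hL, List.mem_map, List.mem_range] at hq
      obtain ⟨t, ht, rfl⟩ := hq
      exact_mod_cast hα (t + 1 + 1) (by omega) (by omega)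
    have hpos : 0 < hj L := by linarith
    have hy : ((α 1 * x1 - x0 : ℤ) : ℚ) = x1 / hj L := by
      push_cast
      field_simp at hval' ⊢
      linear_combination hval'
    have hypos : 0 < (α 1 * x1 - x0 : ℤ) := by
      have : (0 : ℚ) < ((α 1 * x1 - x0 : ℤ) : ℚ) := by rw [hy]; positivity
      exact_mod_cast this
    have hlt : (α 1 * x1 - x0 : ℤ) < x1 := by
      have : ((α 1 * x1 - x0 : ℤ) : ℚ) < x1 := by rw [hy]; exact div_lt_self hx hgt
      exact_mod_cast this
    obtain ⟨hanti, hzero⟩ := ih (fun k => α (k + 1)) x1 (α 1 * x1 - x0)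
      (fun t h1 h2 => hα (t + 1) (by omega) (by omega)) hypos
      (by rw [hy, div_div_cancel₀ hx.ne'])
    refine ⟨fun t ht => ?_, by rw [ser_succ]; exact hzero⟩
    cases t with
    | zero =>
      have h2 : (2 : ℤ) ≤ α 1 := by exact_mod_cast hα 1 le_rfl (by omega)
      simp only [ser]
      constructor <;> nlinarith
    | succ t =>
      rw [ser_succ, ser_succ x0 x1 α t]
      exact hanti t (by omega)

theorem ser_zero_one_lt {n : ℕ} {α : ℕ → ℕ} (hα : ∀ t, 1 ≤ t → t ≤ n → 2 ≤ α t) (t : ℕ)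
    (ht : t ≤ n) : 0 ≤ ser 0 1 α t ∧ ser 0 1 α t < ser 0 1 α (t + 1) := by
  induction t with
  | zero => simp [ser]
  | succ t ih =>
    obtain ⟨h0, h1⟩ := ih (by omega)
    have h2 : (2 : ℤ) ≤ α (t + 1) := by exact_mod_cast hα (t + 1) (by omega) ht
    simp only [ser]
    constructor <;> nlinarith

theorem dvd_ser_of_dvd {g x0 x1 : ℤ} {α : ℕ → ℕ} (m : ℕ) (h0 : g ∣ ser x0 x1 α m)
    (h1 : g ∣ ser x0 x1 α (m + 1)) : g ∣ x0 ∧ g ∣ x1 := by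
  induction m with
  | zero => exact ⟨h0, h1⟩
  | succ m ih =>
    refine ih ?_ h0
    simp only [ser] at h1
    simpa using (h0.mul_left (α (m + 1) : ℤ)).sub h1

/-- Coordinates in the lattice `u + a v ≡ 0 (mod r)` with respect to the basis
`(c, d)`, `(I, -J)`. -/
theorem exists_lattice_coords {r a c d I J u v : ℤ} (hr : r ≠ 0) (hdet : d * I + c * J = r)
    (hIJ : r ∣ I - a * J) (hcd : r ∣ c + a * d) (huv : r ∣ u + a * v) :
    ∃ A B : ℤ, u = A * c + B * I ∧ v = A * d - B * J := by
  have hA : r ∣ u * J + v * I := by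
    refine dvd_trans ((huv.mul_left J).add (hIJ.mul_left v)) (dvd_of_eq ?_)
    ring
  have hB : r ∣ u * d - v * c := by
    refine dvd_trans ((huv.mul_left d).sub (hcd.mul_left v)) (dvd_of_eq ?_)
    ring
  obtain ⟨A, hA⟩ := hA
  obtain ⟨B, hB⟩ := hB
  refine ⟨A, B, mul_left_cancel₀ hr ?_, mul_left_cancel₀ hr ?_⟩
  · linear_combination c * hA + I * hB - u * hdet
  · linear_combination d * hA - J * hB - v * hdet

/-- A point of the box `[0, c) × [0, d)` of weight `Q - I` with `0 ≤ Q ≤ I` is the origin. -/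
theorem box_eq_zero_of_le {r a c d I J Q z₁ z₂ : ℤ} (hr : 0 < r) (hdet : d * I + c * J = r)
    (hIJ : r ∣ I - a * J) (hcd : r ∣ c + a * d) (hI : 0 < I) (hJ : 0 < J)
    (hQI : Q ≤ I) (hQ : 0 ≤ Q) (hz₁ : 0 ≤ z₁) (hz₁c : z₁ < c) (hz₂ : 0 ≤ z₂) (hz₂d : z₂ < d)
    (hz : r ∣ z₁ + a * z₂ - (Q - I)) : z₁ = 0 ∧ z₂ = 0 := by
  obtain ⟨A, B, h1, h2⟩ := exists_lattice_coords (u := z₁ - (Q - I)) (v := z₂) hr.ne' hdet hIJ hcd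
    (hz.trans (dvd_of_eq (by ring)))
  rcases lt_trichotomy A 0 with hA | rfl | hA
  · have hB : B ≤ 0 := by
      by_contra! hB
      nlinarith
    nlinarith
  · have hB : B = 0 := by
      rcases lt_trichotomy B 0 with hB | hB | hB
      · nlinarith
      · exact hB
      · nlinarith
    subst hB
    constructor <;> linarith
  · have hB : 1 ≤ B := by
      by_contra! hB
      nlinarith
    nlinarith

/-- The box `[0, c) × [0, d)` has no point of the weight attached to `Q - J` with `0 ≤ Q < J`. -/
theorem box_false_of_lt {r a c d I J Q z₁ z₂ : ℤ} (hr : 0 < r) (hdet : d * I + c * J = r)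
    (hIJ : r ∣ I - a * J) (hcd : r ∣ c + a * d) (hI : 0 < I) (hJ : 0 < J)
    (hQJ : Q < J) (hQ : 0 ≤ Q) (hz₁ : 0 ≤ z₁) (hz₁c : z₁ < c) (hz₂ : 0 ≤ z₂) (hz₂d : z₂ < d)
    (hz : r ∣ z₁ + a * z₂ - a * (Q - J)) : False := by
  obtain ⟨A, B, h1, h2⟩ := exists_lattice_coords (u := z₁) (v := z₂ - (Q - J)) hr.ne' hdet hIJ hcd
    (hz.trans (dvd_of_eq (by ring)))
  rcases le_or_gt A 0 with hA | hA
  · have hB : 0 ≤ B := by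
      by_contra! hB
      nlinarith
    nlinarith
  · have hB : B ≤ -1 := by
      by_contra! hB
      nlinarith
    nlinarith

/-- The numerical properties of the i- and j-series used in the construction of paths. -/
structure SeriesProps (r a n : ℕ) (α : ℕ → ℕ) : Prop where
  r_pos : 0 < r
  n_pos : 1 ≤ n
  two_le : ∀ t, 1 ≤ t → t ≤ n → 2 ≤ α t
  i_anti : ∀ t, t ≤ n → ser r a α (t + 1) < ser r a α t
  i_nonneg : ∀ t, t ≤ n → 0 ≤ ser r a α (t + 1)
  i_last : ser r a α n = 1
  j_last : ser 0 1 α (n + 1) = r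

namespace SeriesProps

variable {r a n : ℕ} {α : ℕ → ℕ}

theorem of_hj (ha : 1 ≤ a) (har : a < r) (hcop : Nat.Coprime r a) (hn : 1 ≤ n)
    (hα : ∀ t, 1 ≤ t → t ≤ n → 2 ≤ α t)
    (hval : hj ((List.range n).map fun t => (α (t + 1) : ℚ)) = (r : ℚ) / (a : ℚ)) :
    SeriesProps r a n α := by
  obtain ⟨m, rfl⟩ : ∃ m, n = m + 1 := ⟨n - 1, by omega⟩
  obtain ⟨hanti, hzero⟩ := ser_anti_of_hj m α r a hα (by exact_mod_cast ha) (by simpa using hval)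
  have hlast : ser r a α (m + 1) = 1 := by
    have hpos : 0 < ser r a α (m + 1) := by
      have := hanti (m + 1) le_rfl
      omega
    obtain ⟨h0, h1⟩ := dvd_ser_of_dvd (m + 1) (dvd_refl (ser r a α (m + 1))) (by simp [hzero])
    have hdvd := Int.dvd_coe_gcd h0 h1
    rw [Int.gcd_natCast_natCast, hcop.gcd_eq_one] at hdvd
    exact Int.eq_one_of_dvd_one hpos.le (by exact_mod_cast hdvd)
  refine ⟨by omega, hn, hα, fun t ht => (hanti t ht).1, fun t ht => (hanti t ht).2, hlast, ?_⟩
  have hdet := ser_det r a α (m + 1)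
  rw [hlast, hzero] at hdet
  linarith

theorem i_pos (H : SeriesProps r a n α) {t : ℕ} (ht : t ≤ n) : 0 < ser r a α t :=
  (H.i_nonneg t ht).trans_lt (H.i_anti t ht)

theorem i_lt (H : SeriesProps r a n α) {s t : ℕ} (hst : s < t) (ht : t ≤ n) :
    ser r a α t < ser r a α s := by
  induction t, hst using Nat.le_induction with
  | base => exact H.i_anti s (by omega)
  | succ t hst ih => exact (H.i_anti t (by omega)).trans (ih (by omega))

theorem j_lt_succ (H : SeriesProps r a n α) {t : ℕ} (ht : t ≤ n) :
    ser 0 1 α t < ser 0 1 α (t + 1) :=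
  (ser_zero_one_lt H.two_le t ht).2

theorem j_nonneg (H : SeriesProps r a n α) {t : ℕ} (ht : t ≤ n) : 0 ≤ ser 0 1 α t :=
  (ser_zero_one_lt H.two_le t ht).1

theorem j_lt (H : SeriesProps r a n α) {s t : ℕ} (hst : s < t) (ht : t ≤ n) :
    ser 0 1 α s < ser 0 1 α t := by
  induction t, hst using Nat.le_induction with
  | base => exact H.j_lt_succ (by omega)
  | succ t hst ih => exact (ih (by omega)).trans (H.j_lt_succ (by omega))

theorem eq_of_dvd (H : SeriesProps r a n α) {p q : ℕ} (hp : p ≤ n) (hq : q ≤ n)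
    (h : (r : ℤ) ∣ ser r a α q - ser r a α p) : p = q := by
  have hle : ∀ {t}, t ≤ n → ser r a α t ≤ r := fun {t} ht => by
    rcases Nat.eq_zero_or_pos t with rfl | h0
    · simp [ser]
    · exact (H.i_lt h0 ht).le
  have hzero : ser r a α q - ser r a α p = 0 := by
    refine Int.eq_zero_of_abs_lt_dvd h (abs_lt.2 ⟨?_, ?_⟩)
    · linarith [H.i_pos hq, hle hp]
    · linarith [H.i_pos hp, hle hq]
  rcases lt_trichotomy p q with hpq | hpq | hpq
  · linarith [H.i_lt hpq hq]
  · exact hpq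
  · linarith [H.i_lt hpq hp]

/-- A nonzero label of the weight of some map out of `S_{i_p}` is divisible by the label of an
arrow out of `p`. -/
theorem exists_arrow (H : SeriesProps r a n α) {p q z₁ z₂ : ℕ} (hp : p ≤ n) (hq : q ≤ n)
    (hz : (r : ℤ) ∣ z₁ + a * z₂ - (ser r a α q - ser r a α p)) (hz0 : 0 < z₁ + z₂) :
    ∃ w ℓ₁ ℓ₂, w ≤ n ∧ Arrow r a n α p w (ℓ₁, ℓ₂) ∧ ℓ₁ ≤ z₁ ∧ ℓ₂ ≤ z₂ ∧ 0 < ℓ₁ + ℓ₂ ∧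
      (r : ℤ) ∣ ℓ₁ + a * ℓ₂ - (ser r a α w - ser r a α p) := by
  rcases Nat.eq_zero_or_pos p with rfl | hp0
  · rcases Nat.eq_zero_or_pos z₁ with hz₁ | hz₁
    · exact ⟨1, 0, 1, H.n_pos, Or.inr (Or.inr (Or.inl ⟨0, H.n_pos, rfl, rfl, by simp [ser]⟩)),
        by omega, by omega, by omega, by simp [ser]⟩
    · exact ⟨n, 1, 0, le_rfl, Or.inr (Or.inl ⟨rfl, rfl, rfl⟩), by omega, by omega, by omega,
        by rw [H.i_last]; simp [ser]⟩
  obtain ⟨k, rfl⟩ : ∃ k, p = k + 1 := ⟨p - 1, by omega⟩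
  have hiR : ser r a α (k + 1 + 1) = α (k + 1) * ser r a α (k + 1) - ser r a α k := rfl
  have hjR : ser 0 1 α (k + 1 + 1) = α (k + 1) * ser 0 1 α (k + 1) - ser 0 1 α k := rfl
  have hik := H.i_anti k (by omega)
  have hik1 := H.i_nonneg (k + 1) hp
  have hI := H.i_pos hp
  have hjk := H.j_lt_succ (t := k) (by omega)
  have hjk1 := H.j_lt_succ hp
  have hj0 := H.j_nonneg (t := k) (by omega)
  have hdet := ser_det r a α k
  have hd0 := dvd_ser_sub r a α k
  have hd1 := dvd_ser_sub r a α (k + 1)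
  have hd2 := dvd_ser_sub r a α (k + 1 + 1)
  have hdq := dvd_ser_sub r a α q
  have h2 := H.two_le (k + 1) (by omega) hp
  by_cases hc : ser r a α k - ser r a α (k + 1) ≤ z₁
  · refine ⟨k, _, 0, by omega, Or.inl ⟨k + 1, by omega, hp, rfl, rfl, rfl⟩, ?_, by omega, ?_, ?_⟩
    · simp only [Nat.add_sub_cancel]; omega
    · simp only [Nat.add_sub_cancel]; omega
    · rw [Nat.add_sub_cancel, Int.toNat_of_nonneg (by omega)]
      simp
  by_cases hac : ser 0 1 α (k + 1 + 1) - ser 0 1 α (k + 1) ≤ z₂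
  · rcases hp.lt_or_eq with hlt | rfl
    · refine ⟨k + 1 + 1, 0, _, by omega, Or.inr (Or.inr (Or.inl ⟨k + 1, hlt, rfl, rfl, rfl⟩)),
        by omega, by omega, by omega, ?_⟩
      rw [Int.toNat_of_nonneg (by omega)]
      refine dvd_trans (hd1.sub hd2) (dvd_of_eq ?_)
      push_cast
      ring
    · have hjl := H.j_last
      refine ⟨0, 0, _, by omega, Or.inr (Or.inr (Or.inr (Or.inl ⟨rfl, rfl, rfl⟩))),
        by omega, by omega, by omega, ?_⟩
      rw [Int.toNat_of_nonneg (by omega)]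
      refine dvd_trans (hd1.add ((dvd_refl (r : ℤ)).mul_left (a - 1))) (dvd_of_eq ?_)
      simp only [ser]
      push_cast
      ring
  push Not at hc hac
  have hex : ∃ s : ℕ, ser r a α k - ((s : ℤ) + 1) * ser r a α (k + 1) ≤ z₁ :=
    ⟨α (k + 1), by nlinarith⟩
  classical
  set s := Nat.find hex
  have hs_spec : ser r a α k - ((s : ℤ) + 1) * ser r a α (k + 1) ≤ z₁ := Nat.find_spec hex
  have hs0 : 1 ≤ s := by
    by_contra! h
    have : s = 0 := by omega
    rw [this] at hs_spec
    push_cast at hs_spec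
    linarith
  have hsα : s ≤ α (k + 1) - 1 := by
    refine Nat.find_min' hex ?_
    rw [Nat.cast_sub (by omega)]
    push_cast
    linarith
  have hz₁c : (z₁ : ℤ) < ser r a α k - s * ser r a α (k + 1) := by
    have := Nat.find_min hex (m := s - 1) (by omega)
    rw [Nat.cast_sub hs0] at this
    push_cast at this
    linarith
  have hs1 : (1 : ℤ) ≤ s := by exact_mod_cast hs0
  have hdnn : 0 < (s : ℤ) * ser 0 1 α (k + 1) - ser 0 1 α k := by nlinarith
  by_cases hfit : (s : ℤ) * ser 0 1 α (k + 1) - ser 0 1 α k ≤ z₂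
  · have hsα2 : s ≤ α (k + 1) - 2 := by
      by_contra! h
      have : (s : ℤ) = α (k + 1) - 1 := by omega
      rw [this] at hfit
      linarith
    have hcnn : 0 ≤ ser r a α k - ((s : ℤ) + 1) * ser r a α (k + 1) := by
      have : (s : ℤ) + 2 ≤ α (k + 1) := by omega
      have hlt := H.i_anti (k + 1) hp
      have hle := mul_le_mul_of_nonneg_right this hI.le
      linarith
    refine ⟨0, _, _, by omega,
      Or.inr (Or.inr (Or.inr (Or.inr ⟨k + 1, s, by omega, hp, hs0, hsα2, rfl, rfl, rfl⟩))),
      ?_, ?_, ?_, ?_⟩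
    · simp only [Nat.add_sub_cancel]; omega
    · simp only [Nat.add_sub_cancel]; omega
    · simp only [Nat.add_sub_cancel]; omega
    · simp only [Nat.add_sub_cancel]
      rw [Int.toNat_of_nonneg hcnn, Int.toNat_of_nonneg hdnn.le]
      refine dvd_trans ((hd0.sub (hd1.mul_left (s : ℤ))).sub (dvd_refl (r : ℤ))) (dvd_of_eq ?_)
      simp only [ser]
      ring
  push Not at hfit
  have hr : (0 : ℤ) < r := by exact_mod_cast H.r_pos
  have hdet' : ((s : ℤ) * ser 0 1 α (k + 1) - ser 0 1 α k) * ser r a α (k + 1) +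
      (ser r a α k - s * ser r a α (k + 1)) * ser 0 1 α (k + 1) = r := by
    linear_combination hdet
  have hcd : (r : ℤ) ∣ (ser r a α k - s * ser r a α (k + 1)) +
      a * ((s : ℤ) * ser 0 1 α (k + 1) - ser 0 1 α k) := by
    refine dvd_trans (hd0.sub (hd1.mul_left (s : ℤ))) (dvd_of_eq ?_)
    ring
  exfalso
  rcases le_or_gt (k + 1) q with hpq | hpq
  · have hqp : ser r a α q ≤ ser r a α (k + 1) := by
      rcases hpq.eq_or_lt with rfl | h
      · rfl
      · exact (H.i_lt h hq).le
    have := box_eq_zero_of_le hr hdet' hd1 hcd hI (by linarith) hqp (H.i_pos hq).le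
      (by positivity) hz₁c (by positivity) hfit hz
    omega
  · refine box_false_of_lt hr hdet' hd1 hcd hI (by linarith) (H.j_lt hpq hp) (H.j_nonneg hq)
      (by positivity) hz₁c (by positivity) hfit ?_
    refine dvd_trans ((hz.add hdq).sub hd1) (dvd_of_eq ?_)
    ring

theorem reflTransGen (H : SeriesProps r a n α) (N : ℕ) : ∀ {p q z₁ z₂ : ℕ} (b₁ b₂ : ℕ),
    z₁ + z₂ = N → p ≤ n → q ≤ n →
    (r : ℤ) ∣ z₁ + a * z₂ - (ser r a α q - ser r a α p) →
    Relation.ReflTransGen (StepQ r a n α) (p, b₁, b₂) (q, b₁ + z₁, b₂ + z₂) := by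
  induction N using Nat.strong_induction_on with
  | _ N ih =>
    intro p q z₁ z₂ b₁ b₂ hN hp hq hz
    rcases Nat.eq_zero_or_pos N with rfl | hpos
    · obtain ⟨rfl, rfl⟩ : z₁ = 0 ∧ z₂ = 0 := by omega
      obtain rfl := H.eq_of_dvd hp hq (by simpa [dvd_sub_comm] using hz)
      exact Relation.ReflTransGen.refl
    · obtain ⟨w, ℓ₁, ℓ₂, hw, harr, h₁, h₂, hℓ, hdvd⟩ := H.exists_arrow hp hq hz (by omega)
      obtain ⟨y₁, rfl⟩ := Nat.exists_eq_add_of_le h₁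
      obtain ⟨y₂, rfl⟩ := Nat.exists_eq_add_of_le h₂
      refine Relation.ReflTransGen.head (b := (w, b₁ + ℓ₁, b₂ + ℓ₂))
        ⟨(ℓ₁, ℓ₂), harr, rfl, rfl⟩ ?_
      rw [← add_assoc, ← add_assoc]
      refine ih (y₁ + y₂) (by omega) _ _ rfl hw hq ?_
      refine dvd_trans (hz.sub hdvd) (dvd_of_eq ?_)
      push_cast
      ring

end SeriesProps

/-- every map `S_{i_p} -> S_{i_q}` with `p < q` can be seen in the diagram
of special Cohen-Macaulay modules. -/
theorem stmt_10 (r a n : ℕ) (α : ℕ → ℕ)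
    (ha : 1 ≤ a) (har : a < r) (hcop : Nat.Coprime r a) (hn : 1 ≤ n)
    (hα : ∀ t, 1 ≤ t → t ≤ n → 2 ≤ α t)
    (hval : hj ((List.range n).map fun t => (α (t + 1) : ℚ)) = (r : ℚ) / (a : ℚ)) :
    ∀ p q, p < q → q ≤ n → ∀ z₁ z₂ : ℕ,
      ((z₁ : ℤ) + (a : ℤ) * (z₂ : ℤ)) ≡ ser r a α q - ser r a α p [ZMOD (r : ℤ)] →
      HasPath r a n α p q z₁ z₂ := by
  intro p q hpq hq z₁ z₂ hz
  have H := SeriesProps.of_hj ha har hcop hn hα hval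
  simpa [HasPath] using H.reflTransGen _ 0 0 rfl (hpq.le.trans hq) hq hz.symm.dvd
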